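/- arXiv:2310.16404 — 2 statements merged into one kernel-verified Lean document; each statement's English description precedes it below -/
import Mathlib

section
/- (Single-step estimate for the Nesterov-second-scheme ADMM.) Under the Problem setup, let {(x_k, y_k, λ_k, u_k, v_k, λ̄_k, λ̂_k)}_{k≥1} satisfy Scheme B with α, β, γ > 0 and {t_k}_{k≥1} ⊆ [1, +∞) nondecreasing with t_{k+1}² ≤ t_k² + t_{k+1} for all k ≥ 1. Then for every (x*, y*, λ*) ∈ Ω and every k ≥ 1, E_{k+1} − E_k ≤ ((t_{k+2}² − t_{k+1}² − β·μ_g·t_{k+1})/(2β))·‖v_{k+1} − y*‖² − ((1 − α·L_{f2})/(2α))·‖u_{k+1} − u_k‖² − ((t_{k+1}² − β·L_{g2})/(2β))·‖v_{k+1} − v_k‖² − (μ_g·t_{k+1}²·(t_{k+1} − 1)/2)·‖y_{k+1} − y_k‖² + (1/(2γ))·‖λ_{k+1} − λ̄_{k+1}‖² + t_{k+1}·⟨B(v_{k+1} − y*), λ̄_{k+1} − λ̂_{k+1}⟩. -/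
set_option autoImplicit false

open RealInnerProductSpace

/-- The Lagrangian `𝓛(x,y,λ) = f1 x + f2 x + g1 y + g2 y + ⟪λ, Ax + By − b⟫`. -/
noncomputable def Lagr {m n p : ℕ}
    (f1 f2 : EuclideanSpace ℝ (Fin m) → ℝ)
    (g1 g2 : EuclideanSpace ℝ (Fin n) → ℝ)
    (A : EuclideanSpace ℝ (Fin m) →L[ℝ] EuclideanSpace ℝ (Fin p))
    (B : EuclideanSpace ℝ (Fin n) →L[ℝ] EuclideanSpace ℝ (Fin p))
    (b : EuclideanSpace ℝ (Fin p))
    (x : EuclideanSpace ℝ (Fin m)) (y : EuclideanSpace ℝ (Fin n))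
    (l : EuclideanSpace ℝ (Fin p)) : ℝ :=
  f1 x + f2 x + g1 y + g2 y + ⟪l, A x + B y - b⟫

section SmoothConvex

variable {E : Type*} [NormedAddCommGroup E] [InnerProductSpace ℝ E]

theorem HasGradientAt.hasDerivAt_lineMap [CompleteSpace E] {f : E → ℝ} {g a d : E} {s : ℝ}
    (h : HasGradientAt f g (a + s • d)) :
    HasDerivAt (fun r : ℝ => f (a + r • d)) ⟪g, d⟫ s := by
  have hline : HasDerivAt (fun r : ℝ => a + r • d) d s := by
    simpa using ((hasDerivAt_id s).smul_const d).const_add a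
  have := (hasGradientAt_iff_hasFDerivAt.mp h).comp_hasDerivAt s hline
  rwa [InnerProductSpace.toDual_apply_apply] at this

theorem ConvexOn.add_inner_le_of_hasGradientAt [CompleteSpace E] {f : E → ℝ} {g a : E}
    (hf : ConvexOn ℝ Set.univ f) (h : HasGradientAt f g a) (z : E) :
    f a + ⟪g, z - a⟫ ≤ f z := by
  have hconv : ConvexOn ℝ Set.univ (fun r : ℝ => f (a + r • (z - a))) := by
    have := hf.comp_affineMap (AffineMap.lineMap a z : ℝ →ᵃ[ℝ] E)
    refine (this.congr fun r _ => ?_)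
    simp [AffineMap.lineMap_apply, add_comm]
  have hd : HasDerivAt (fun r : ℝ => f (a + r • (z - a))) ⟪g, z - a⟫ 0 :=
    HasGradientAt.hasDerivAt_lineMap (by simpa using h)
  have := hconv.le_slope_of_hasDerivAt (Set.mem_univ 0) (Set.mem_univ 1) one_pos hd
  simp [slope_def_field] at this
  linarith

theorem le_add_inner_add_sq_of_lipschitz_gradient [CompleteSpace E] {f : E → ℝ} {f' : E → E}
    {L : ℝ} (hgrad : ∀ x, HasGradientAt f (f' x) x)
    (hlip : ∀ x y, ‖f' x - f' y‖ ≤ L * ‖x - y‖) (a z : E) :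
    f z ≤ f a + ⟪f' a, z - a⟫ + L / 2 * ‖z - a‖ ^ 2 := by
  set d := z - a with hd
  have hf : ∀ s : ℝ, HasDerivAt (fun r : ℝ => f (a + r • d)) ⟪f' (a + s • d), d⟫ s :=
    fun s => (hgrad _).hasDerivAt_lineMap
  have hB : ∀ s : ℝ, HasDerivAt
      (fun r : ℝ => f a + r * ⟪f' a, d⟫ + L / 2 * ‖d‖ ^ 2 * r ^ 2)
      (⟪f' a, d⟫ + L * ‖d‖ ^ 2 * s) s := fun s => by
    have h1 := (((hasDerivAt_id s).mul_const ⟪f' a, d⟫).const_add (f a)).add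
      (((hasDerivAt_id s).pow 2).const_mul (L / 2 * ‖d‖ ^ 2))
    refine h1.congr_deriv ?_ |>.congr_of_eventuallyEq (.of_forall fun r => ?_)
    · simp
      ring
    · simp
  have key := image_le_of_deriv_right_le_deriv_boundary (a := 0) (b := 1)
    (fun s _ => (hf s).continuousAt.continuousWithinAt)
    (fun s _ => (hf s).hasDerivWithinAt) (by simp)
    (fun s _ => (hB s).continuousAt.continuousWithinAt)
    (fun s _ => (hB s).hasDerivWithinAt)
    (fun s hs => by
      have h1 : ⟪f' (a + s • d) - f' a, d⟫ ≤ L * ‖d‖ ^ 2 * s := by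
        calc ⟪f' (a + s • d) - f' a, d⟫ ≤ ‖f' (a + s • d) - f' a‖ * ‖d‖ :=
              real_inner_le_norm _ _
          _ ≤ L * ‖a + s • d - a‖ * ‖d‖ := by gcongr; exact hlip _ _
          _ = L * ‖d‖ ^ 2 * s := by
              rw [add_sub_cancel_left, norm_smul, Real.norm_of_nonneg hs.1]; ring
      rw [inner_sub_left] at h1
      linarith)
    (Set.right_mem_Icc.mpr zero_le_one)
  simpa [hd] using key

theorem StrongConvexOn.add_inner_add_sq_le {f : E → ℝ} {μ : ℝ} {q a : E}
    (hf : StrongConvexOn Set.univ μ f) (hq : ∀ z, f a + ⟪q, z - a⟫ ≤ f z) (z : E) :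
    f a + ⟪q, z - a⟫ + μ / 2 * ‖z - a‖ ^ 2 ≤ f z := by
  have hs : ∀ s ∈ Set.Ioo (0 : ℝ) 1,
      f a + ⟪q, z - a⟫ + (1 - s) * (μ / 2 * ‖z - a‖ ^ 2) ≤ f z := by
    rintro s ⟨hs0, hs1⟩
    have h1 := hf.2 (Set.mem_univ a) (Set.mem_univ z) (sub_nonneg.mpr hs1.le) hs0.le
      (sub_add_cancel 1 s)
    have h2 := hq ((1 - s) • a + s • z)
    have h3 : (1 - s) • a + s • z - a = s • (z - a) := by module
    rw [h3, inner_smul_right] at h2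
    simp only [smul_eq_mul, norm_sub_rev a z] at h1
    nlinarith
  have hlim : Filter.Tendsto
      (fun s : ℝ => f a + ⟪q, z - a⟫ + (1 - s) * (μ / 2 * ‖z - a‖ ^ 2))
      (nhdsWithin 0 (Set.Ioi 0)) (nhds (f a + ⟪q, z - a⟫ + μ / 2 * ‖z - a‖ ^ 2)) := by
    have hc : Continuous
        (fun s : ℝ => f a + ⟪q, z - a⟫ + (1 - s) * (μ / 2 * ‖z - a‖ ^ 2)) := by fun_prop
    simpa using (hc.tendsto 0).mono_left nhdsWithin_le_nhds
  exact le_of_tendsto hlim (Filter.eventually_of_mem (Ioo_mem_nhdsGT one_pos) hs)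

/-- One accelerated forward-backward step for `h₁ + h₂`, tested against the previous iterate `a`
and a reference point `c`. -/
theorem accelerated_step_le [CompleteSpace E] {h₁ h₂ : E → ℝ} {h₂' : E → E} {μ L T : ℝ}
    (hsc : StrongConvexOn Set.univ μ h₁) (hconv : ConvexOn ℝ Set.univ h₂)
    (hgrad : ∀ x, HasGradientAt h₂ (h₂' x) x)
    (hlip : ∀ x y, ‖h₂' x - h₂' y‖ ≤ L * ‖x - y‖) (hT : 1 ≤ T)
    {a a' e w w' q : E} (hq : ∀ z, h₁ a' + ⟪q, z - a'⟫ ≤ h₁ z)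
    (ha' : T • a' = w' + (T - 1) • a) (he : T • e = w + (T - 1) • a) (c : E) :
    T ^ 2 * (h₁ a' + h₂ a') - T * (T - 1) * (h₁ a + h₂ a) - T * (h₁ c + h₂ c) ≤
      T * ⟪q + h₂' e, w' - c⟫ + L / 2 * ‖w' - w‖ ^ 2
        - μ / 2 * (T * ‖c - a'‖ ^ 2 + T * (T - 1) * ‖a - a'‖ ^ 2) := by
  have hstep : ∀ z, h₁ a' + h₂ a' ≤ h₁ z + h₂ z + ⟪q + h₂' e, a' - z⟫
      + L / 2 * ‖a' - e‖ ^ 2 - μ / 2 * ‖z - a'‖ ^ 2 := fun z => by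
    have h1 := hsc.add_inner_add_sq_le hq z
    have h2 := hconv.add_inner_le_of_hasGradientAt (hgrad e) z
    have h3 := le_add_inner_add_sq_of_lipschitz_gradient hgrad hlip e a'
    simp only [inner_add_left, inner_sub_right] at *
    linarith
  have h1 := mul_le_mul_of_nonneg_left (hstep c) (by linarith : 0 ≤ T)
  have h2 := mul_le_mul_of_nonneg_left (hstep a)
    (mul_nonneg (by linarith) (by linarith) : 0 ≤ T * (T - 1))
  have hw : w' - w = T • (a' - e) := by rw [smul_sub, ha', he]; abel
  have hwc : w' - c = (a' - c) + (T - 1) • (a' - a) := by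
    have : w' = T • a' - (T - 1) • a := by rw [ha']; abel
    rw [this]; module
  have hn : ‖w' - w‖ ^ 2 = T ^ 2 * ‖a' - e‖ ^ 2 := by
    rw [hw, norm_smul, mul_pow, Real.norm_eq_abs, sq_abs]
  rw [hn, hwc, inner_add_right, inner_smul_right]
  linarith

theorem two_mul_inner_sub_sub (a b c : E) :
    2 * ⟪b - a, b - c⟫ = ‖b - c‖ ^ 2 + ‖b - a‖ ^ 2 - ‖a - c‖ ^ 2 := by
  have h : a - c = (b - c) - (b - a) := by abel
  rw [h, norm_sub_sq_real (b - c), real_inner_comm]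
  ring

/-- In Nesterov's second scheme the extrapolated point is the averaging step at the old `w`. -/
theorem smul_extrapolation_eq {s T : ℝ} (hT : T ≠ 0) {a₀ a w e : E}
    (ha : s • a = w + (s - 1) • a₀) (he : e = a + ((s - 1) / T) • (a - a₀)) :
    T • e = w + (T - 1) • a := by
  have hw : w = s • a - (s - 1) • a₀ := by rw [ha]; abel
  rw [he, hw, smul_add, smul_smul, mul_div_cancel₀ _ hT]
  module

theorem smul_average_eq {T : ℝ} (hT : T ≠ 0) {a a' w' : E}
    (h : a' = (1 / T) • w' + ((T - 1) / T) • a) : T • a' = w' + (T - 1) • a := by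
  rw [h, smul_add, smul_smul, smul_smul, mul_div_cancel₀ _ hT, mul_div_cancel₀ _ hT, one_smul]

end SmoothConvex

/-- The multiplier of a saddle point forces feasibility of its primal part. -/
theorem feasible_of_forall_Lagr_le {m n p : ℕ}
    {f1 f2 : EuclideanSpace ℝ (Fin m) → ℝ} {g1 g2 : EuclideanSpace ℝ (Fin n) → ℝ}
    {A : EuclideanSpace ℝ (Fin m) →L[ℝ] EuclideanSpace ℝ (Fin p)}
    {B : EuclideanSpace ℝ (Fin n) →L[ℝ] EuclideanSpace ℝ (Fin p)}
    {b : EuclideanSpace ℝ (Fin p)} {x : EuclideanSpace ℝ (Fin m)}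
    {y : EuclideanSpace ℝ (Fin n)} {l : EuclideanSpace ℝ (Fin p)}
    (h : ∀ l', Lagr f1 f2 g1 g2 A B b x y l' ≤ Lagr f1 f2 g1 g2 A B b x y l) :
    A x + B y = b := by
  have h1 := h (l + (A x + B y - b))
  simp only [Lagr, inner_add_left] at h1
  rw [← sub_eq_zero, ← inner_self_eq_zero (𝕜 := ℝ)]
  exact le_antisymm (by linarith) real_inner_self_nonneg

/-- Single-step estimate (Lemma 3.1) for the Nesterov-second-scheme accelerated
linearized ADMM (Scheme B). -/
theorem stmt12 {m n p : ℕ}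
    (A : EuclideanSpace ℝ (Fin m) →L[ℝ] EuclideanSpace ℝ (Fin p))
    (B : EuclideanSpace ℝ (Fin n) →L[ℝ] EuclideanSpace ℝ (Fin p))
    (b : EuclideanSpace ℝ (Fin p))
    (f1 f2 : EuclideanSpace ℝ (Fin m) → ℝ)
    (g1 g2 : EuclideanSpace ℝ (Fin n) → ℝ)
    (f2' : EuclideanSpace ℝ (Fin m) → EuclideanSpace ℝ (Fin m))
    (g2' : EuclideanSpace ℝ (Fin n) → EuclideanSpace ℝ (Fin n))
    (Lf2 Lg2 μ : ℝ) (hLf2 : 0 ≤ Lf2) (hLg2 : 0 ≤ Lg2) (hμ : 0 < μ)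
    -- Assumption 1.1
    (hf1lsc : LowerSemicontinuous f1) (hf1conv : ConvexOn ℝ Set.univ f1)
    (hf2conv : ConvexOn ℝ Set.univ f2)
    (hf2grad : ∀ x, HasGradientAt f2 (f2' x) x)
    (hf2lip : ∀ x y, ‖f2' x - f2' y‖ ≤ Lf2 * ‖x - y‖)
    (hg1lsc : LowerSemicontinuous g1) (hg1sc : StrongConvexOn Set.univ μ g1)
    (hg2conv : ConvexOn ℝ Set.univ g2)
    (hg2grad : ∀ y, HasGradientAt g2 (g2' y) y)
    (hg2lip : ∀ x y, ‖g2' x - g2' y‖ ≤ Lg2 * ‖x - y‖)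
    -- parameters
    (α β γ : ℝ) (hα : 0 < α) (hβ : 0 < β) (hγ : 0 < γ)
    (t : ℕ → ℝ) (ht1 : ∀ k ≥ 1, 1 ≤ t k) (htmono : ∀ k ≥ 1, t k ≤ t (k + 1))
    (htrec : ∀ k ≥ 1, t (k + 1) ^ 2 ≤ t k ^ 2 + t (k + 1))
    -- iterates of Scheme B
    (x u xbar : ℕ → EuclideanSpace ℝ (Fin m))
    (y v ybar : ℕ → EuclideanSpace ℝ (Fin n))
    (lam lambar lamhat : ℕ → EuclideanSpace ℝ (Fin p))
    (ξ : ℕ → EuclideanSpace ℝ (Fin m)) (ζ : ℕ → EuclideanSpace ℝ (Fin n))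
    (hx0 : x 0 = x 1) (hy0 : y 0 = y 1) (hu1 : u 1 = x 1) (hv1 : v 1 = y 1)
    (hxbar : ∀ k ≥ 1, xbar k = x k + ((t k - 1) / t (k + 1)) • (x k - x (k - 1)))
    (hybar : ∀ k ≥ 1, ybar k = y k + ((t k - 1) / t (k + 1)) • (y k - y (k - 1)))
    (hξ : ∀ k ≥ 1, ∀ z, f1 (x (k + 1)) + ⟪ξ (k + 1), z - x (k + 1)⟫ ≤ f1 z)
    (hu : ∀ k ≥ 1, u (k + 1) - u k =
      -((α * t (k + 1)) • (ξ (k + 1) + f2' (xbar k) +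
        ContinuousLinearMap.adjoint A (lambar (k + 1)))))
    (hζ : ∀ k ≥ 1, ∀ z, g1 (y (k + 1)) + ⟪ζ (k + 1), z - y (k + 1)⟫ ≤ g1 z)
    (hv : ∀ k ≥ 1, v (k + 1) - v k =
      -((β / t (k + 1)) • (ζ (k + 1) + g2' (ybar k) +
        ContinuousLinearMap.adjoint B (lamhat (k + 1)) +
        μ • (v (k + 1) - y (k + 1)))))
    (hxupd : ∀ k ≥ 1, x (k + 1) =
      (1 / t (k + 1)) • u (k + 1) + ((t (k + 1) - 1) / t (k + 1)) • x k)
    (hyupd : ∀ k ≥ 1, y (k + 1) =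
      (1 / t (k + 1)) • v (k + 1) + ((t (k + 1) - 1) / t (k + 1)) • y k)
    (hlam : ∀ k ≥ 1, lam (k + 1) =
      lam k + (γ * t (k + 1)) • (A (u (k + 1)) + B (v (k + 1)) - b))
    (hlambar : ∀ k ≥ 1, lambar (k + 1) =
      lam k + (γ * t (k + 1)) • (A (u (k + 1)) + B (v k) - b))
    (hlamhat : ∀ k ≥ 1, lamhat (k + 1) = lam (k + 1) ∨ lamhat (k + 1) = lambar (k + 1))
    -- saddle point
    (xs : EuclideanSpace ℝ (Fin m)) (ys : EuclideanSpace ℝ (Fin n))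
    (lams : EuclideanSpace ℝ (Fin p))
    (hsaddle : ∀ xx yy ll,
      Lagr f1 f2 g1 g2 A B b xs ys ll ≤ Lagr f1 f2 g1 g2 A B b xs ys lams ∧
      Lagr f1 f2 g1 g2 A B b xs ys lams ≤ Lagr f1 f2 g1 g2 A B b xx yy lams) :
    -- conclusion
    let En : ℕ → ℝ := fun j =>
      t j ^ 2 * (Lagr f1 f2 g1 g2 A B b (x j) (y j) lams -
        Lagr f1 f2 g1 g2 A B b xs ys lams) +
      1 / (2 * α) * ‖u j - xs‖ ^ 2 + t (j + 1) ^ 2 / (2 * β) * ‖v j - ys‖ ^ 2 +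
      1 / (2 * γ) * ‖lam j - lams‖ ^ 2
    ∀ k ≥ 1,
      En (k + 1) - En k ≤
        (t (k + 2) ^ 2 - t (k + 1) ^ 2 - β * μ * t (k + 1)) / (2 * β) *
          ‖v (k + 1) - ys‖ ^ 2
        - (1 - α * Lf2) / (2 * α) * ‖u (k + 1) - u k‖ ^ 2
        - (t (k + 1) ^ 2 - β * Lg2) / (2 * β) * ‖v (k + 1) - v k‖ ^ 2
        - μ * t (k + 1) ^ 2 * (t (k + 1) - 1) / 2 * ‖y (k + 1) - y k‖ ^ 2
        + 1 / (2 * γ) * ‖lam (k + 1) - lambar (k + 1)‖ ^ 2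
        + t (k + 1) * ⟪B (v (k + 1) - ys), lambar (k + 1) - lamhat (k + 1)⟫ := by
  intro En k hk
  have hT := ht1 (k + 1) (by omega)
  have hTne : t (k + 1) ≠ 0 := by positivity
  have havgx : ∀ j ≥ 1, t j • x j = u j + (t j - 1) • x (j - 1) := by
    intro j hj
    obtain rfl | ⟨i, hi, rfl⟩ : j = 1 ∨ ∃ i ≥ 1, j = i + 1 :=
      (eq_or_lt_of_le hj).imp Eq.symm fun h => ⟨j - 1, by omega, by omega⟩
    · simp only [Nat.sub_self, hx0, hu1]; module
    · have := ht1 (i + 1) hj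
      exact smul_average_eq (by positivity) (hxupd i hi)
  have havgy : ∀ j ≥ 1, t j • y j = v j + (t j - 1) • y (j - 1) := by
    intro j hj
    obtain rfl | ⟨i, hi, rfl⟩ : j = 1 ∨ ∃ i ≥ 1, j = i + 1 :=
      (eq_or_lt_of_le hj).imp Eq.symm fun h => ⟨j - 1, by omega, by omega⟩
    · simp only [Nat.sub_self, hy0, hv1]; module
    · have := ht1 (i + 1) hj
      exact smul_average_eq (by positivity) (hyupd i hi)
  have hx' := havgx (k + 1) (by omega)
  have hy' := havgy (k + 1) (by omega)
  rw [Nat.add_sub_cancel] at hx' hy'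
  have hfstep := accelerated_step_le (strongConvexOn_zero.mpr hf1conv) hf2conv hf2grad hf2lip hT
    (hξ k hk) hx' (smul_extrapolation_eq hTne (havgx k hk) (hxbar k hk)) xs
  have hgstep := accelerated_step_le hg1sc hg2conv hg2grad hg2lip hT
    (hζ k hk) hy' (smul_extrapolation_eq hTne (havgy k hk) (hybar k hk)) ys
  have hfeas : A xs + B ys = b := feasible_of_forall_Lagr_le fun l => (hsaddle xs ys l).1
  have hgap := (hsaddle (x k) (y k) lams).2
  have hrec := htrec k hk
  have huk := hu k hk
  have hvk := hv k hk
  have hlk := hlam k hk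
  simp only [En, show k + 1 + 1 = k + 2 from rfl]
  generalize t (k + 1) = T at *
  have hT0 : 0 < T := by linarith
  -- inner products of the update directions
  have huin : T * ⟪ξ (k + 1) + f2' (xbar k), u (k + 1) - xs⟫ =
      1 / (2 * α) * (‖u k - xs‖ ^ 2 - ‖u (k + 1) - xs‖ ^ 2 - ‖u (k + 1) - u k‖ ^ 2)
        - T * ⟪lambar (k + 1), A (u (k + 1) - xs)⟫ := by
    have h1 := two_mul_inner_sub_sub (u k) (u (k + 1)) xs
    rw [huk, inner_neg_left, inner_smul_left, inner_add_left (_ + _),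
      ContinuousLinearMap.adjoint_inner_left, ← huk] at h1
    simp only [conj_trivial] at h1
    field_simp
    linarith
  have hvy : v (k + 1) - y (k + 1) = (T - 1) • (y (k + 1) - y k) := by
    have : v (k + 1) = T • y (k + 1) - (T - 1) • y k := by rw [hy']; abel
    rw [this]; module
  have hvin : T * ⟪ζ (k + 1) + g2' (ybar k), v (k + 1) - ys⟫ =
      T ^ 2 / (2 * β) * (‖v k - ys‖ ^ 2 - ‖v (k + 1) - ys‖ ^ 2 - ‖v (k + 1) - v k‖ ^ 2)
        - T * ⟪lamhat (k + 1), B (v (k + 1) - ys)⟫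
        - T * μ * ⟪v (k + 1) - y (k + 1), v (k + 1) - ys⟫ := by
    have h1 := two_mul_inner_sub_sub (v k) (v (k + 1)) ys
    rw [hvk, inner_neg_left, inner_smul_left, inner_add_left (_ + _ + _),
      inner_add_left (_ + _),
      ContinuousLinearMap.adjoint_inner_left, inner_smul_left, ← hvk] at h1
    simp only [conj_trivial] at h1
    field_simp at h1 ⊢
    linarith
  have hvyin := two_mul_inner_sub_sub (y (k + 1)) (v (k + 1)) ys
  have hvyn : ‖v (k + 1) - y (k + 1)‖ ^ 2 = (T - 1) ^ 2 * ‖y (k + 1) - y k‖ ^ 2 := by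
    rw [hvy, norm_smul, mul_pow, Real.norm_eq_abs, sq_abs]
  -- the coupling terms
  have hres : A (u (k + 1)) + B (v (k + 1)) - b =
      A (u (k + 1) - xs) + B (v (k + 1) - ys) := by
    rw [map_sub, map_sub, ← hfeas]; abel
  have hcoup : T ^ 2 * ⟪lams, A (x (k + 1)) + B (y (k + 1)) - b⟫
      - T * (T - 1) * ⟪lams, A (x k) + B (y k) - b⟫ =
      T * ⟪lams, A (u (k + 1) - xs) + B (v (k + 1) - ys)⟫ := by
    have h1 : T • (A (x (k + 1)) + B (y (k + 1)) - b) =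
        (A (u (k + 1)) + B (v (k + 1)) - b) + (T - 1) • (A (x k) + B (y k) - b) := by
      rw [smul_sub, smul_add, ← map_smul, ← map_smul, hx', hy']
      simp only [map_add, map_smul]
      module
    have h2 := congrArg (fun r => T * ⟪lams, r⟫) h1
    simp only [inner_add_right lams (_ - b), inner_smul_right] at h2
    rw [← hres]
    linarith
  have hdual : T * ⟪lams - lambar (k + 1), A (u (k + 1) - xs) + B (v (k + 1) - ys)⟫
      + 1 / (2 * γ) * (‖lam (k + 1) - lams‖ ^ 2 - ‖lam k - lams‖ ^ 2) ≤
      1 / (2 * γ) * ‖lam (k + 1) - lambar (k + 1)‖ ^ 2 := by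
    have h1 : lam (k + 1) - lam k =
        (γ * T) • (A (u (k + 1) - xs) + B (v (k + 1) - ys)) := by
      rw [hlk, hres]; abel
    have h2 := two_mul_inner_sub_sub (lam k) (lam (k + 1)) lams
    have h3 := two_mul_inner_sub_sub (lam k) (lam (k + 1)) (lambar (k + 1))
    have h4 : ⟪lam (k + 1) - lam k, lam (k + 1) - lambar (k + 1)⟫ -
        ⟪lam (k + 1) - lam k, lam (k + 1) - lams⟫ =
        γ * T * ⟪lams - lambar (k + 1), A (u (k + 1) - xs) + B (v (k + 1) - ys)⟫ := by
      rw [← inner_sub_right, sub_sub_sub_cancel_left, real_inner_comm, h1, inner_smul_right]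
    have h5 := sq_nonneg ‖lam k - lambar (k + 1)‖
    field_simp
    linarith
  have hsadval : ⟪lams, A xs + B ys - b⟫ = 0 := by simp [hfeas]
  have hmain := mul_le_mul_of_nonneg_right (by linarith : T * (T - 1) ≤ t k ^ 2)
    (sub_nonneg.mpr hgap)
  simp only [Lagr] at hmain ⊢
  rw [hsadval] at hmain ⊢
  rw [inner_sub_right (B _), real_inner_comm (lambar (k + 1)) (B _),
    real_inner_comm (lamhat (k + 1)) (B _)]
  rw [inner_sub_left, inner_add_right, inner_add_right] at hdual
  rw [inner_add_right lams (A (u (k + 1) - xs))] at hcoup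
  rw [huin] at hfstep
  rw [hvin] at hgstep
  rw [hvyn] at hvyin
  rw [norm_sub_rev ys, norm_sub_rev (y k)] at hgstep
  have e1 : (1 - α * Lf2) / (2 * α) = 1 / (2 * α) - Lf2 / 2 := by field_simp
  have e2 : (T ^ 2 - β * Lg2) / (2 * β) = T ^ 2 / (2 * β) - Lg2 / 2 := by field_simp
  have e3 : (t (k + 2) ^ 2 - T ^ 2 - β * μ * T) / (2 * β) =
      t (k + 2) ^ 2 / (2 * β) - T ^ 2 / (2 * β) - μ * T / 2 := by field_simp
  rw [e1, e2, e3]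
  linear_combination hfstep + hgstep + hcoup + hdual + hmain - (T * μ / 2) * hvyin
end

section
/- (Accelerated linearized ALM, Nesterov's second scheme, convex case.) Consider minimizing f(x) = f1(x) + f2(x) over x ∈ ℝ^m subject to Ax = b, where f1 : ℝ^m → ℝ is lower semicontinuous and convex, f2 : ℝ^m → ℝ is convex and differentiable with L_{f2}-Lipschitz gradient, and the saddle point set Ω of the Lagrangian 𝓛(x,λ) = f(x) + ⟨λ, Ax − b⟩ is nonempty. Let (x*, λ*) ∈ Ω. Let the iterates, started from x_1 = x_0 ∈ ℝ^m, u_1 = x_1, λ_1 ∈ ℝ^p, with α, γ > 0 and {t_k}_{k≥1} ⊆ [1, +∞) nondecreasing satisfying t_{k+1}² ≤ t_k² + t_{k+1}, be given for k ≥ 1 by: x̄_k = x_k + ((t_k − 1)/t_{k+1})·(x_k − x_{k−1}); u_{k+1} − u_k = −α·t_{k+1}·(ξ_{k+1} + ∇f2(x̄_k) + Aᵀλ̄_{k+1}) for some ξ_{k+1} ∈ ∂f1(x_{k+1}), where λ̄_{k+1} = λ_k + γ·t_{k+1}·(A u_{k+1} − b); u_{k+1} = x_{k+1} + (t_{k+1}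 − 1)·(x_{k+1} − x_k); λ_{k+1} = λ_k + γ·t_{k+1}·(A u_{k+1} − b). If α ≤ 1/L_{f2}, then for all k ≥ 1: ‖A x_k − b‖ ≤ C_3/t_k² and |f(x_k) − f(x*)| ≤ (E_1 + C_3·‖λ*‖)/t_k², where E_1 = t_1²·(f(x_1) − f(x*) + ⟨λ*, A x_1 − b⟩) + (1/(2α))·‖x_1 − x*‖² + (1/(2γ))·‖λ_1 − λ*‖² and C_3 = 3·t_1²·‖A x_1 − b‖ + (2‖λ_1 − λ*‖ + 2√(2γ·E_1))/γ. -/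
set_option autoImplicit false

open RealInnerProductSpace

section SmoothConvex

variable {E : Type*} [NormedAddCommGroup E] [InnerProductSpace ℝ E] [CompleteSpace E]

theorem HasGradientAt.hasDerivAt_add_smul {f : E → ℝ} {g x d : E} {s : ℝ}
    (h : HasGradientAt f g (x + s • d)) :
    HasDerivAt (fun r : ℝ => f (x + r • d)) ⟪g, d⟫ s := by
  have h1 : HasDerivAt (fun r : ℝ => x + r • d) d s := by
    simpa using ((hasDerivAt_id s).smul_const d).const_add x
  simpa [Function.comp_def] using h.hasFDerivAt.comp_hasDerivAt s h1

/-- First-order characterization of convexity. -/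
theorem ConvexOn.add_inner_gradient_le {f : E → ℝ} (hf : ConvexOn ℝ Set.univ f) {g x : E}
    (hg : HasGradientAt f g x) (y : E) : f x + ⟪g, y - x⟫ ≤ f y := by
  have hd : HasDerivAt (fun r : ℝ => f (x + r • (y - x))) ⟪g, y - x⟫ 0 :=
    HasGradientAt.hasDerivAt_add_smul (by simpa using hg)
  have hc : ConvexOn ℝ Set.univ (fun r : ℝ => f (x + r • (y - x))) := by
    have := hf.comp_affineMap (AffineMap.lineMap x y : ℝ →ᵃ[ℝ] E)
    simpa [Function.comp_def, AffineMap.lineMap_apply, add_comm] using this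
  have := hc.le_slope_of_hasDerivAt (Set.mem_univ 0) (Set.mem_univ 1) one_pos hd
  simp [slope_def_field] at this
  linarith

/-- The descent lemma: a function with `L`-Lipschitz gradient lies below its quadratic models. -/
theorem le_quadratic_of_lipschitz_gradient {f : E → ℝ} {f' : E → E} {L : ℝ}
    (hg : ∀ x, HasGradientAt f (f' x) x) (hL : ∀ x y, ‖f' x - f' y‖ ≤ L * ‖x - y‖) (x y : E) :
    f y ≤ f x + ⟪f' x, y - x⟫ + L / 2 * ‖y - x‖ ^ 2 := by
  set d := y - x with hd
  have hφ (s : ℝ) : HasDerivAt (fun r : ℝ => f (x + r • d)) ⟪f' (x + s • d), d⟫ s :=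
    (hg _).hasDerivAt_add_smul
  have hB (s : ℝ) : HasDerivAt (fun r : ℝ => f x + r * ⟪f' x, d⟫ + L / 2 * ‖d‖ ^ 2 * r ^ 2)
      (⟪f' x, d⟫ + L * ‖d‖ ^ 2 * s) s := by
    have := (((hasDerivAt_id s).mul_const ⟪f' x, d⟫).const_add (f x)).add
      (((hasDerivAt_id s).pow 2).const_mul (L / 2 * ‖d‖ ^ 2))
    exact this.congr_deriv (by norm_num; ring)
  have key := image_le_of_deriv_right_le_deriv_boundary (a := (0 : ℝ)) (b := 1)
    (fun s _ => (hφ s).continuousAt.continuousWithinAt) (fun s _ => (hφ s).hasDerivWithinAt)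
    (by simp) (fun s _ => (hB s).continuousAt.continuousWithinAt)
    (fun s _ => (hB s).hasDerivWithinAt) (fun s hs => by
      have h1 : ⟪f' (x + s • d) - f' x, d⟫ ≤ ‖f' (x + s • d) - f' x‖ * ‖d‖ :=
        real_inner_le_norm _ _
      have h2 : ‖f' (x + s • d) - f' x‖ ≤ L * (s * ‖d‖) := by
        simpa [norm_smul, abs_of_nonneg hs.1] using hL (x + s • d) x
      have h3 := mul_le_mul_of_nonneg_right h2 (norm_nonneg d)
      rw [inner_sub_left] at h1
      linarith) (Set.right_mem_Icc.2 zero_le_one)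
  simp only [one_smul, one_mul, one_pow, mul_one] at key
  simpa [hd] using key

/-- The basic inequality of a forward-backward step from `y` to `x`, compared at `z`. -/
theorem composite_le_of_subgradient {f₁ f₂ : E → ℝ} {f₂' : E → E} {L : ℝ}
    (hconv : ConvexOn ℝ Set.univ f₂) (hg : ∀ x, HasGradientAt f₂ (f₂' x) x)
    (hL : ∀ x y, ‖f₂' x - f₂' y‖ ≤ L * ‖x - y‖) {x ξ : E}
    (hξ : ∀ z, f₁ x + ⟪ξ, z - x⟫ ≤ f₁ z) (y z : E) :
    f₁ x + f₂ x ≤ f₁ z + f₂ z + ⟪ξ + f₂' y, x - z⟫ + L / 2 * ‖x - y‖ ^ 2 := by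
  have h1 := hξ z
  have h2 := hconv.add_inner_gradient_le (hg y) z
  have h3 := le_quadratic_of_lipschitz_gradient hg hL y x
  simp only [inner_add_left, inner_sub_right] at h1 h2 h3 ⊢
  linarith

end SmoothConvex

section Averaging

variable {F : Type*} [NormedAddCommGroup F] [NormedSpace ℝ F]

/-- If `a (k + 1) - (1 - θ k) • a k = s (k + 1) - s k` with `θ k ∈ [0, 1]`, then `a` is controlled
by bounds on `s k - s 1 + a 1`. -/
theorem norm_le_two_mul_of_relaxed_telescoping {a s : ℕ → F} {θ : ℕ → ℝ} {C : ℝ}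
    (hθ0 : ∀ k ≥ 1, 0 ≤ θ k) (hθ1 : ∀ k ≥ 1, θ k ≤ 1)
    (hrec : ∀ k ≥ 1, a (k + 1) - (1 - θ k) • a k = s (k + 1) - s k)
    (hC : ∀ k ≥ 1, ‖s k - s 1 + a 1‖ ≤ C) : ∀ k ≥ 1, ‖a k‖ ≤ 2 * C := by
  have hw : ∀ k ≥ 1, ‖s k - s 1 + a 1 - a k‖ ≤ C := by
    intro k hk
    induction k, hk using Nat.le_induction with
    | base => simpa using (norm_nonneg _).trans (hC 1 le_rfl)
    | succ k hk ih =>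
      have heq : s (k + 1) - s 1 + a 1 - a (k + 1) =
          (1 - θ k) • (s k - s 1 + a 1 - a k) + θ k • (s k - s 1 + a 1) := by
        have h : s (k + 1) = s k + (a (k + 1) - (1 - θ k) • a k) := by rw [hrec k hk]; abel
        rw [h]
        module
      have h0 := hθ0 k hk
      have h1 : 0 ≤ 1 - θ k := sub_nonneg.2 (hθ1 k hk)
      calc _ ≤ (1 - θ k) * ‖s k - s 1 + a 1 - a k‖ + θ k * ‖s k - s 1 + a 1‖ := by
            rw [heq]
            refine (norm_add_le _ _).trans_eq ?_
            rw [norm_smul, norm_smul, Real.norm_of_nonneg h0, Real.norm_of_nonneg h1]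
        _ ≤ (1 - θ k) * C + θ k * C := by gcongr; exact hC k hk
        _ = C := by ring
  intro k hk
  have h := norm_sub_le (s k - s 1 + a 1) (s k - s 1 + a 1 - a k)
  rw [sub_sub_cancel] at h
  linarith [hC k hk, hw k hk]

end Averaging

/-- Accelerated linearized ALM based on Nesterov's second scheme (Algorithm 7),
convex case (Theorem 3.4): convergence rates for the one-block linearly constrained
problem `min f1 + f2 s.t. Ax = b`. -/
theorem stmt15 {m p : ℕ}
    (A : EuclideanSpace ℝ (Fin m) →L[ℝ] EuclideanSpace ℝ (Fin p))
    (b : EuclideanSpace ℝ (Fin p))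
    (f1 f2 : EuclideanSpace ℝ (Fin m) → ℝ)
    (f2' : EuclideanSpace ℝ (Fin m) → EuclideanSpace ℝ (Fin m))
    (Lf2 : ℝ) (hLf2 : 0 ≤ Lf2)
    (hf1lsc : LowerSemicontinuous f1) (hf1conv : ConvexOn ℝ Set.univ f1)
    (hf2conv : ConvexOn ℝ Set.univ f2)
    (hf2grad : ∀ x, HasGradientAt f2 (f2' x) x)
    (hf2lip : ∀ x y, ‖f2' x - f2' y‖ ≤ Lf2 * ‖x - y‖)
    (α γ : ℝ) (hα : 0 < α) (hγ : 0 < γ) (hαle : α ≤ 1 / Lf2)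
    (t : ℕ → ℝ) (ht1 : ∀ k ≥ 1, 1 ≤ t k) (htmono : ∀ k ≥ 1, t k ≤ t (k + 1))
    (htrec : ∀ k ≥ 1, t (k + 1) ^ 2 ≤ t k ^ 2 + t (k + 1))
    (x u xbar : ℕ → EuclideanSpace ℝ (Fin m))
    (lam lambar : ℕ → EuclideanSpace ℝ (Fin p))
    (ξ : ℕ → EuclideanSpace ℝ (Fin m))
    (hx0 : x 0 = x 1) (hu1 : u 1 = x 1)
    (hxbar : ∀ k ≥ 1, xbar k = x k + ((t k - 1) / t (k + 1)) • (x k - x (k - 1)))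
    (hξ : ∀ k ≥ 1, ∀ z, f1 (x (k + 1)) + ⟪ξ (k + 1), z - x (k + 1)⟫ ≤ f1 z)
    (hu : ∀ k ≥ 1, u (k + 1) - u k =
      -((α * t (k + 1)) • (ξ (k + 1) + f2' (xbar k) +
        ContinuousLinearMap.adjoint A (lambar (k + 1)))))
    (hlambar : ∀ k ≥ 1, lambar (k + 1) = lam k + (γ * t (k + 1)) • (A (u (k + 1)) - b))
    (huupd : ∀ k ≥ 1, u (k + 1) = x (k + 1) + (t (k + 1) - 1) • (x (k + 1) - x k))
    (hlam : ∀ k ≥ 1, lam (k + 1) = lam k + (γ * t (k + 1)) • (A (u (k + 1)) - b))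
    -- saddle point of the Lagrangian `𝓛(x,λ) = f1 x + f2 x + ⟪λ, A x − b⟫`
    (xs : EuclideanSpace ℝ (Fin m)) (lams : EuclideanSpace ℝ (Fin p))
    (hsaddle : ∀ (xx : EuclideanSpace ℝ (Fin m)) (ll : EuclideanSpace ℝ (Fin p)),
      f1 xs + f2 xs + ⟪ll, A xs - b⟫ ≤ f1 xs + f2 xs + ⟪lams, A xs - b⟫ ∧
      f1 xs + f2 xs + ⟪lams, A xs - b⟫ ≤ f1 xx + f2 xx + ⟪lams, A xx - b⟫) :
    let E1 : ℝ :=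
      t 1 ^ 2 * (f1 (x 1) + f2 (x 1) - (f1 xs + f2 xs) + ⟪lams, A (x 1) - b⟫) +
      1 / (2 * α) * ‖x 1 - xs‖ ^ 2 + 1 / (2 * γ) * ‖lam 1 - lams‖ ^ 2
    let C3 : ℝ :=
      3 * t 1 ^ 2 * ‖A (x 1) - b‖ +
        (2 * ‖lam 1 - lams‖ + 2 * Real.sqrt (2 * γ * E1)) / γ
    ∀ k ≥ 1,
      ‖A (x k) - b‖ ≤ C3 / t k ^ 2 ∧
      |f1 (x k) + f2 (x k) - (f1 xs + f2 xs)| ≤ (E1 + C3 * ‖lams‖) / t k ^ 2 := by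
  intro E1 C3
  have hL : 0 < Lf2 := hLf2.lt_of_ne (by rintro rfl; simp at hαle; linarith)
  have hαL : Lf2 ≤ 1 / α := (le_one_div hα hL).1 hαle
  have hAxs : A xs - b = 0 := by
    have h := (hsaddle xs (lams + (A xs - b))).1
    rw [inner_add_left, real_inner_self_eq_norm_sq] at h
    have : ‖A xs - b‖ ^ 2 = 0 := le_antisymm (by linarith) (sq_nonneg _)
    simpa using this
  have hxs : A xs = b := sub_eq_zero.1 hAxs
  set G : ℕ → ℝ := fun k => f1 (x k) + f2 (x k) - (f1 xs + f2 xs) + ⟪lams, A (x k) - b⟫ with hG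
  have hG0 (k : ℕ) : 0 ≤ G k := by
    have h := (hsaddle (x k) lams).2
    rw [hAxs, inner_zero_right] at h
    simp only [hG]
    linarith
  have hstep : ∀ k ≥ 1, u (k + 1) - u k = t (k + 1) • (x (k + 1) - xbar k) := by
    intro k hk
    have ht : t (k + 1) ≠ 0 := (one_pos.trans_le (ht1 (k + 1) (by omega))).ne'
    have huk : u k = x k + (t k - 1) • (x k - x (k - 1)) := by
      rcases k with _ | _ | k
      · omega
      · simp [hu1, hx0]
      · exact huupd (k + 1) (by omega)
    have hT : t (k + 1) • (((t k - 1) / t (k + 1)) • (x k - x (k - 1))) =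
        (t k - 1) • (x k - x (k - 1)) := by rw [smul_smul, mul_div_cancel₀ _ ht]
    rw [huupd k hk, huk, hxbar k hk, smul_sub (t (k + 1)), smul_add (t (k + 1)), hT]
    module
  set V : ℕ → ℝ := fun k => t k ^ 2 * G k + 1 / (2 * α) * ‖u k - xs‖ ^ 2 +
    1 / (2 * γ) * ‖lam k - lams‖ ^ 2 with hV
  have hVstep : ∀ k ≥ 1, V (k + 1) ≤ V k := by
    intro k hk
    have hT1 := ht1 (k + 1) (by omega)
    set T := t (k + 1) with hT
    have hT0 : 0 < T := one_pos.trans_le hT1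
    set η := ξ (k + 1) + f2' (xbar k) with hη
    have i1 := composite_le_of_subgradient hf2conv hf2grad hf2lip (hξ k hk) (xbar k) (x k)
    have i2 := composite_le_of_subgradient hf2conv hf2grad hf2lip (hξ k hk) (xbar k) xs
    rw [← hη] at i1 i2
    have i3 := mul_le_mul_of_nonneg_left i1 (mul_nonneg hT0.le (sub_nonneg.2 hT1))
    have i4 := mul_le_mul_of_nonneg_left i2 hT0.le
    have hsq : ‖u (k + 1) - u k‖ ^ 2 = T ^ 2 * ‖x (k + 1) - xbar k‖ ^ 2 := by
      rw [hstep k hk, norm_smul, Real.norm_of_nonneg hT0.le, mul_pow]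
    have hη1 : (T - 1) * ⟪η, x (k + 1) - x k⟫ + ⟪η, x (k + 1) - xs⟫ = ⟪η, u (k + 1) - xs⟫ := by
      rw [huupd k hk, ← inner_smul_right, ← inner_add_right]
      congr 1
      module
    have hη2 : T * ⟪η, u (k + 1) - xs⟫ = -(1 / α) * ⟪u (k + 1) - u k, u (k + 1) - xs⟫ -
        T * ⟪lam (k + 1), A (u (k + 1)) - b⟫ := by
      have hll : lambar (k + 1) = lam (k + 1) := by rw [hlambar k hk, hlam k hk]
      rw [hu k hk, ← hη, hll, inner_neg_left, inner_smul_left,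
        inner_add_left η, ContinuousLinearMap.adjoint_inner_left, map_sub, hxs]
      simp only [conj_trivial]
      field_simp
      ring
    have hr : A (u (k + 1)) - b = T • (A (x (k + 1)) - b) - (T - 1) • (A (x k) - b) := by
      rw [huupd k hk, map_add, map_smul, map_sub]
      module
    have hr1 : ⟪lams, A (u (k + 1)) - b⟫ =
        T * ⟪lams, A (x (k + 1)) - b⟫ - (T - 1) * ⟪lams, A (x k) - b⟫ := by
      rw [hr, inner_sub_right, inner_smul_right, inner_smul_right]
    have hdual : T * ⟪lam (k + 1) - lams, A (u (k + 1)) - b⟫ =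
        1 / γ * ⟪lam (k + 1) - lams, lam (k + 1) - lam k⟫ := by
      have h : lam (k + 1) - lam k = (γ * T) • (A (u (k + 1)) - b) := by
        rw [hlam k hk]; abel
      rw [h, inner_smul_right]
      field_simp
    have p1 : 2 * ⟪u (k + 1) - u k, u (k + 1) - xs⟫ =
        ‖u (k + 1) - u k‖ ^ 2 + ‖u (k + 1) - xs‖ ^ 2 - ‖u k - xs‖ ^ 2 := by
      have h := norm_sub_sq_real (u (k + 1) - xs) (u (k + 1) - u k)
      rw [show u (k + 1) - xs - (u (k + 1) - u k) = u k - xs by abel, real_inner_comm] at h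
      linarith
    have p2 : 2 * ⟪lam (k + 1) - lams, lam (k + 1) - lam k⟫ =
        ‖lam (k + 1) - lam k‖ ^ 2 + ‖lam (k + 1) - lams‖ ^ 2 - ‖lam k - lams‖ ^ 2 := by
      have h := norm_sub_sq_real (lam (k + 1) - lams) (lam (k + 1) - lam k)
      rw [show lam (k + 1) - lams - (lam (k + 1) - lam k) = lam k - lams by abel] at h
      linarith
    have q1 : Lf2 * ‖u (k + 1) - u k‖ ^ 2 ≤ 1 / α * ‖u (k + 1) - u k‖ ^ 2 := by gcongr
    have q2 : 0 ≤ 1 / γ * ‖lam (k + 1) - lam k‖ ^ 2 := by positivity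
    have q3 : T ^ 2 * G k ≤ (t k ^ 2 + T) * G k :=
      mul_le_mul_of_nonneg_right (htrec k hk) (hG0 k)
    have main : T ^ 2 * G (k + 1) - (T ^ 2 - T) * G k ≤
        -(1 / α) * ⟪u (k + 1) - u k, u (k + 1) - xs⟫ -
        1 / γ * ⟪lam (k + 1) - lams, lam (k + 1) - lam k⟫ + Lf2 / 2 * ‖u (k + 1) - u k‖ ^ 2 := by
      rw [← hdual, inner_sub_left (lam (k + 1)), hr1, hsq]
      have h := congrArg (T * ·) hη1
      simp only [hη2] at h
      simp only [hG]
      linarith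
    have e1 : 1 / α * (2 * ⟪u (k + 1) - u k, u (k + 1) - xs⟫) = _ := congrArg (1 / α * ·) p1
    have e2 : 1 / γ * (2 * ⟪lam (k + 1) - lams, lam (k + 1) - lam k⟫) = _ :=
      congrArg (1 / γ * ·) p2
    have c1 : 1 / (2 * α) = 1 / α / 2 := by field_simp
    have c2 : 1 / (2 * γ) = 1 / γ / 2 := by field_simp
    simp only [hV, c1, c2]
    linarith
  have hVE : ∀ k ≥ 1, V k ≤ E1 := by
    intro k hk
    induction k, hk using Nat.le_induction with
    | base => simp only [hV, hG, hu1]; exact le_rfl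
    | succ k hk ih => exact (hVstep k hk).trans ih
  have hGE : ∀ k ≥ 1, t k ^ 2 * G k ≤ E1 := by
    intro k hk
    have h1 : 0 ≤ 1 / (2 * α) * ‖u k - xs‖ ^ 2 := by positivity
    have h2 : 0 ≤ 1 / (2 * γ) * ‖lam k - lams‖ ^ 2 := by positivity
    have := hVE k hk
    simp only [hV] at this
    linarith
  have hlamE : ∀ k ≥ 1, ‖lam k - lams‖ ≤ Real.sqrt (2 * γ * E1) := by
    intro k hk
    apply Real.le_sqrt_of_sq_le
    have h1 : 0 ≤ 1 / (2 * α) * ‖u k - xs‖ ^ 2 := by positivity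
    have h2 : 0 ≤ t k ^ 2 * G k := mul_nonneg (sq_nonneg _) (hG0 k)
    have h3 : 1 / (2 * γ) * ‖lam k - lams‖ ^ 2 ≤ E1 := by
      have := hVE k hk
      simp only [hV] at this
      linarith
    calc _ = 2 * γ * (1 / (2 * γ) * ‖lam k - lams‖ ^ 2) := by field_simp
      _ ≤ _ := by gcongr
  have hfeas : ∀ k ≥ 1, ‖t k ^ 2 • (A (x k) - b)‖ ≤ C3 := by
    intro k hk
    have h := norm_le_two_mul_of_relaxed_telescoping
      (a := fun k => t k ^ 2 • (A (x k) - b)) (s := fun k => γ⁻¹ • lam k)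
      (θ := fun k => (t k ^ 2 + t (k + 1) - t (k + 1) ^ 2) / t k ^ 2)
      (C := (‖lam 1 - lams‖ + Real.sqrt (2 * γ * E1)) / γ + t 1 ^ 2 * ‖A (x 1) - b‖)
      (fun k hk => div_nonneg (by linarith [htrec k hk]) (sq_nonneg _))
      (fun k hk => by
        have := ht1 (k + 1) (by omega)
        exact div_le_one_of_le₀ (by nlinarith) (sq_nonneg _))
      (fun k hk => by
        have ht : t k ≠ 0 := (one_pos.trans_le (ht1 k hk)).ne'
        have hr : A (u (k + 1)) - b =
            t (k + 1) • (A (x (k + 1)) - b) - (t (k + 1) - 1) • (A (x k) - b) := by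
          rw [huupd k hk, map_add, map_smul, map_sub]
          module
        have hs : γ⁻¹ • lam (k + 1) - γ⁻¹ • lam k = t (k + 1) • (A (u (k + 1)) - b) := by
          rw [← smul_sub, hlam k hk, add_sub_cancel_left, smul_smul, inv_mul_cancel_left₀ hγ.ne']
        have hc : (1 - (t k ^ 2 + t (k + 1) - t (k + 1) ^ 2) / t k ^ 2) * t k ^ 2 =
            t (k + 1) ^ 2 - t (k + 1) := by
          field_simp
          ring
        rw [hs, hr, smul_smul, hc]
        module)
      (fun k hk => by
        have h1 : ‖lam k - lam 1‖ ≤ ‖lam 1 - lams‖ + Real.sqrt (2 * γ * E1) := by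
          have := norm_sub_le (lam k - lams) (lam 1 - lams)
          rw [sub_sub_sub_cancel_right] at this
          linarith [hlamE k hk]
        refine (norm_add_le _ _).trans ?_
        rw [← smul_sub, norm_smul, norm_smul, Real.norm_of_nonneg (inv_nonneg.2 hγ.le),
          Real.norm_of_nonneg (sq_nonneg (t 1)), div_eq_inv_mul]
        gcongr)
      k hk
    have h0 : 0 ≤ t 1 ^ 2 * ‖A (x 1) - b‖ := by positivity
    refine h.trans ?_
    have hC3 : C3 = 3 * t 1 ^ 2 * ‖A (x 1) - b‖ +
      2 * ((‖lam 1 - lams‖ + Real.sqrt (2 * γ * E1)) / γ) := by simp only [C3]; ring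
    rw [hC3]
    linarith
  intro k hk
  have ht : 0 < t k ^ 2 := pow_pos (one_pos.trans_le (ht1 k hk)) 2
  have hA : t k ^ 2 * ‖A (x k) - b‖ ≤ C3 := by
    have := hfeas k hk
    rwa [norm_smul, Real.norm_of_nonneg ht.le] at this
  refine ⟨(le_div_iff₀' ht).2 hA, (le_div_iff₀' ht).2 ?_⟩
  have h1 : t k ^ 2 * |⟪lams, A (x k) - b⟫| ≤ C3 * ‖lams‖ :=
    calc _ ≤ t k ^ 2 * (‖lams‖ * ‖A (x k) - b‖) := by gcongr; exact abs_real_inner_le_norm _ _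
      _ = t k ^ 2 * ‖A (x k) - b‖ * ‖lams‖ := by ring
      _ ≤ _ := by gcongr
  have h2 : |f1 (x k) + f2 (x k) - (f1 xs + f2 xs)| ≤ G k + |⟪lams, A (x k) - b⟫| := by
    have h := abs_sub (G k) ⟪lams, A (x k) - b⟫
    rw [abs_of_nonneg (hG0 k)] at h
    simpa [hG] using h
  have h3 := mul_le_mul_of_nonneg_left h2 ht.le
  linarith [hGE k hk]
end
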